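/- Let U be a finite nonempty variable set and 𝒞 = {C_1,...,C_m} a finite nonempty, enumerated collection of clauses, each clause a subset of U of size at least 2. Then (U,𝒞) admits an NAE-assignment if and only if the graph G'(U,𝒞) is strongly conflict-free vertex-connection 3-colorable. -/

import Mathlib

/-- The vertex type of the modified gadget graph `G'(U, 𝒞)` for an enumerated
collection of `m` clauses: a vertex for each variable in `U`, a clause vertex `c_j`
for each `j`, a path vertex `c_{j, j+1}` for each `1 ≤ j ≤ m - 1` (`mid`), and 21
extra vertices `a_1, ..., a_7`, `b_1, ..., b_7`, `h_1, ..., h_7` (indexed here by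
`Fin 7`, so `A 0` is `a_1`, etc.). -/
inductive GV' (U : Type) (m : ℕ) : Type
  | var : U → GV' U m
  | cls : Fin m → GV' U m
  | mid : Fin (m - 1) → GV' U m
  | A : Fin 7 → GV' U m
  | B : Fin 7 → GV' U m
  | H : Fin 7 → GV' U m

/-- The edges of the modified gadget graph `G'(U, 𝒞)` (given as a relation, to be
symmetrized): `h_i a_i`, `a_i h_{i+1}`, `h_{i+1} b_i`, `b_i h_i` for `1 ≤ i ≤ 6`;
`h_7 a_7` and `h_7 b_7`; an edge between clause vertex `c_j` and variable vertex `v`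
whenever `v ∈ C_j`; edges `a_7 c_j` and `b_7 c_j` for every `1 ≤ j ≤ m`; edges
`h_1 v` for every variable `v ∈ U`; and the path edges `c_j c_{j, j+1}` and
`c_{j, j+1} c_{j+1}` for `1 ≤ j ≤ m - 1`. -/
def gadgetRel' {U : Type} {m : ℕ} (Cl : Fin m → Finset U) :
    GV' U m → GV' U m → Prop
  | .H i, .A j => i = j ∨ i.val = j.val + 1
  | .H i, .B j => i = j ∨ i.val = j.val + 1
  | .cls j, .var v => v ∈ Cl j
  | .A i, .cls _ => i.val = 6
  | .B i, .cls _ => i.val = 6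
  | .H i, .var _ => i.val = 0
  | .mid j, .cls i => i.val = j.val ∨ i.val = j.val + 1
  | _, _ => False

/-- The modified gadget graph `G'(U, 𝒞)` (the clause vertices joined into a path via
the vertices `c_{j, j+1}`). -/
def gadgetGraph' {U : Type} {m : ℕ} (Cl : Fin m → Finset U) :
    SimpleGraph (GV' U m) :=
  SimpleGraph.fromRel (gadgetRel' Cl)

/-- A walk in a vertex-colored graph is conflict-free if some color appears on
exactly one vertex of the walk. -/
def ConflictFree {V α : Type*} {G : SimpleGraph V} (f : V → α) {u v : V}
    (p : G.Walk u v) : Prop :=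
  ∃ c : α, ∃! x, x ∈ p.support ∧ f x = c

/-- A coloring `f` is a strong conflict-free vertex-connection coloring if every two
distinct vertices are joined by a conflict-free shortest path. -/
def IsStrongCfvc {V α : Type*} (G : SimpleGraph V) (f : V → α) : Prop :=
  ∀ u v : V, u ≠ v →
    ∃ p : G.Walk u v, p.IsPath ∧ p.length = G.dist u v ∧ ConflictFree f p

open SimpleGraph

/-- In a graph whose colour class `0` is one side of a bipartition, a walk between two vertices
of colour `0` can be rerouted so that it avoids one of the other two colours, provided that all
common neighbours of vertices of colour `0` can be exchanged for ones of any nonzero colour. -/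
theorem exists_walk_forall_color_eq {V : Type*} {G : SimpleGraph V} {f : V → Fin 3}
    (hbip : ∀ x y, G.Adj x y → (f x = 0 ↔ f y ≠ 0))
    (hswap : ∀ x w y, f x = 0 → G.Adj x w → G.Adj w y → ∀ k ≠ 0,
      ∃ w', G.Adj x w' ∧ G.Adj w' y ∧ f w' = k)
    {k : Fin 3} (hk : k ≠ 0) {x y : V} (p : G.Walk x y) (hx : f x = 0) (hy : f y = 0) :
    ∃ q : G.Walk x y, q.length = p.length ∧ ∀ w ∈ q.support, f w = 0 ∨ f w = k := by
  match p with
  | .nil => exact ⟨.nil, rfl, by simp [hx]⟩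
  | .cons h .nil => exact absurd hy ((hbip _ _ h).1 hx)
  | .cons (v := v) h (.cons (v := z) h' p') =>
    have hz : f z = 0 := by
      have h1 := hbip _ _ h
      have h2 := hbip _ _ h'
      tauto
    obtain ⟨q, hq, hqc⟩ := exists_walk_forall_color_eq hbip hswap hk p' hz hy
    obtain ⟨w, hxw, hwz, hw⟩ := hswap x v z hx h h' k hk
    refine ⟨.cons hxw (.cons hwz q), by simp [hq], fun u hu => ?_⟩
    simp only [Walk.support_cons, List.mem_cons] at hu
    rcases hu with rfl | rfl | hu
    · exact .inl hx
    · exact .inr hw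
    · exact hqc u hu

/-- A criterion for a colouring with one bipartition side as a colour class to be a strong
conflict-free vertex-connection colouring. -/
theorem isStrongCfvc_of_swap {V : Type*} {G : SimpleGraph V} (hG : G.Connected) {f : V → Fin 3}
    (hbip : ∀ x y, G.Adj x y → (f x = 0 ↔ f y ≠ 0))
    (hswap : ∀ x w y, f x = 0 → G.Adj x w → G.Adj w y → ∀ k ≠ 0,
      ∃ w', G.Adj x w' ∧ G.Adj w' y ∧ f w' = k) :
    IsStrongCfvc G f := by
  have other : ∀ i : Fin 3, i ≠ 0 → ∃ k : Fin 3, k ≠ 0 ∧ k ≠ i := by decide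
  -- From a vertex of colour `0`, a walk can be rerouted to have exactly one vertex of colour `k`.
  have one : ∀ {x y : V} (p : G.Walk x y), f x = 0 → f y = 0 → 0 < p.length →
      ∀ k k' : Fin 3, k ≠ 0 → k' ≠ 0 → k' ≠ k → ∃ q : G.Walk x y, q.length = p.length ∧
        (∃! w, w ∈ q.support ∧ f w = k) ∧ ∀ w ∈ q.support, f w = 0 ∨ f w = k ∨ f w = k' := by
    intro x y p hx hy hp k k' hk hk' hkk'
    match p with
    | .nil => simp at hp
    | .cons h .nil => exact absurd hy ((hbip _ _ h).1 hx)
    | .cons (v := v) h (.cons (v := z) h' p') =>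
      have hz : f z = 0 := by
        have h1 := hbip _ _ h
        have h2 := hbip _ _ h'
        tauto
      obtain ⟨q, hq, hqc⟩ := exists_walk_forall_color_eq hbip hswap hk' p' hz hy
      obtain ⟨w, hxw, hwz, hw⟩ := hswap x v z hx h h' k hk
      refine ⟨.cons hxw (.cons hwz q), by simp [hq], ⟨w, ⟨by simp, hw⟩, ?_⟩, ?_⟩
      · rintro u ⟨hu, huk⟩
        simp only [Walk.support_cons, List.mem_cons] at hu
        rcases hu with rfl | rfl | hu
        · exact absurd (huk.symm.trans hx) hk
        · rfl
        · rcases hqc u hu with h0 | h0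
          · exact absurd (huk.symm.trans h0) hk
          · exact absurd (h0.symm.trans huk) hkk'
      · intro u hu
        simp only [Walk.support_cons, List.mem_cons] at hu
        rcases hu with rfl | rfl | hu
        · exact .inl hx
        · exact .inr (.inl hw)
        · exact (hqc u hu).imp id .inr
  intro u v huv
  suffices h : ∃ p : G.Walk u v, p.length = G.dist u v ∧ ConflictFree f p by
    obtain ⟨p, hp, hc⟩ := h
    exact ⟨p, p.isPath_of_length_eq_dist hp, hp, hc⟩
  obtain ⟨p, hp⟩ := hG.exists_walk_length_eq_dist u v
  rw [← hp]
  clear hp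
  have hpos : 0 < p.length := by
    rcases Nat.eq_zero_or_pos p.length with h | h
    · exact absurd (Walk.eq_of_length_eq_zero h) huv
    · exact h
  by_cases hu : f u = 0 <;> by_cases hv : f v = 0
  · obtain ⟨q, hq, hc, -⟩ := one p hu hv hpos 1 2 (by decide) (by decide) (by decide)
    exact ⟨q, hq, 1, hc⟩
  · obtain ⟨k, hk, hkv⟩ := other _ hv
    obtain ⟨z, p', h, rfl⟩ : ∃ (z : V) (p' : G.Walk u z) (h : G.Adj z v), p = p'.concat h := by
      cases p with
      | nil => simp at hpos
      | cons h q =>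
        obtain ⟨z, p', h', e⟩ := Walk.exists_cons_eq_concat h q
        exact ⟨z, p', h', e⟩
    obtain ⟨q, hq, hqc⟩ := exists_walk_forall_color_eq hbip hswap hk p' hu ((hbip _ _ h).2 hv)
    refine ⟨q.concat h, by simp [hq], f v, v, by simp, ?_⟩
    rintro w ⟨hw, hwv⟩
    simp only [Walk.support_concat, List.mem_append,
      List.mem_singleton] at hw
    rcases hw with hw | rfl
    · rcases hqc w hw with h0 | h0
      · exact absurd (hwv.symm.trans h0) hv
      · exact absurd (h0.symm.trans hwv) hkv
    · rfl
  · obtain ⟨k, hk, hku⟩ := other _ hu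
    cases p with
    | nil => simp at hpos
    | @cons _ z _ h p' =>
      have hz : f z = 0 := by
        have := hbip _ _ h
        tauto
      obtain ⟨q, hq, hqc⟩ := exists_walk_forall_color_eq hbip hswap hk p' hz hv
      refine ⟨.cons h q, by simp [hq], f u, u, by simp, ?_⟩
      rintro w ⟨hw, hwv⟩
      simp only [Walk.support_cons, List.mem_cons] at hw
      rcases hw with rfl | hw
      · rfl
      · rcases hqc w hw with h0 | h0
        · exact absurd (hwv.symm.trans h0) hu
        · exact absurd (h0.symm.trans hwv) hku
  · cases p with
    | nil => simp at hpos
    | @cons _ x _ h p' =>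
      have hx : f x = 0 := by
        have := hbip _ _ h
        tauto
      obtain ⟨y, p, h', rfl⟩ : ∃ (y : V) (p : G.Walk x y) (h : G.Adj y v), p' = p.concat h := by
        cases p' with
        | nil => exact absurd hx hv
        | cons h q =>
          obtain ⟨z, p', h', e⟩ := Walk.exists_cons_eq_concat h q
          exact ⟨z, p', h', e⟩
      have hy : f y = 0 := (hbip _ _ h').2 hv
      have mem : ∀ (q : G.Walk x y) w, w ∈ (Walk.cons h (q.concat h')).support ↔
          w = u ∨ w ∈ q.support ∨ w = v := by
        intro q w
        simp [Walk.support_concat]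
      by_cases hp : p.length = 0
      · obtain rfl := Walk.eq_of_length_eq_zero hp
        obtain rfl := Walk.eq_nil_iff_nil.2 (Walk.length_eq_zero_iff.1 hp)
        refine ⟨_, rfl, 0, x, ⟨(mem _ _).2 (by simp), hx⟩, ?_⟩
        rintro w ⟨hw, hw0⟩
        rcases (mem _ _).1 hw with rfl | hw | rfl
        · exact absurd hw0 hu
        · simpa using hw
        · exact absurd hw0 hv
      · by_cases huv' : f u = f v
        · obtain ⟨k, hk, hku⟩ := other _ hu
          obtain ⟨q, hq, ⟨w, ⟨hw, hwk⟩, huniq⟩, -⟩ :=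
            one p hx hy (Nat.pos_of_ne_zero hp) k (f u) hk hu hku.symm
          refine ⟨.cons h (q.concat h'), by simp [hq], k, w,
            ⟨(mem _ _).2 (.inr (.inl hw)), hwk⟩, ?_⟩
          rintro t ⟨ht, htk⟩
          rcases (mem _ _).1 ht with rfl | ht | rfl
          · exact absurd htk.symm hku
          · exact huniq t ⟨ht, htk⟩
          · exact absurd (huv'.trans htk).symm hku
        · obtain ⟨q, hq, hqc⟩ := exists_walk_forall_color_eq hbip hswap hu p hx hy
          refine ⟨.cons h (q.concat h'), by simp [hq], f v, v, ⟨(mem _ _).2 (by simp), rfl⟩, ?_⟩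
          rintro t ⟨ht, htv⟩
          rcases (mem _ _).1 ht with rfl | ht | rfl
          · exact absurd htv huv'
          · rcases hqc t ht with h0 | h0
            · exact absurd (htv.symm.trans h0) hv
            · exact absurd (h0.symm.trans htv) huv'
          · rfl

section gadget

variable {U : Type} {m : ℕ} {Cl : Fin m → Finset U}

@[simp] theorem gadget_adj_H_A {i j : Fin 7} :
    (gadgetGraph' Cl).Adj (.H i) (.A j) ↔ i = j ∨ i.val = j.val + 1 := by
  simp [gadgetGraph', gadgetRel']

@[simp] theorem gadget_adj_H_B {i j : Fin 7} :
    (gadgetGraph' Cl).Adj (.H i) (.B j) ↔ i = j ∨ i.val = j.val + 1 := by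
  simp [gadgetGraph', gadgetRel']

@[simp] theorem gadget_adj_cls_var {j : Fin m} {v : U} :
    (gadgetGraph' Cl).Adj (.cls j) (.var v) ↔ v ∈ Cl j := by
  simp [gadgetGraph', gadgetRel']

@[simp] theorem gadget_adj_A_cls {i : Fin 7} {j : Fin m} :
    (gadgetGraph' Cl).Adj (.A i) (.cls j) ↔ i.val = 6 := by
  simp [gadgetGraph', gadgetRel']

@[simp] theorem gadget_adj_B_cls {i : Fin 7} {j : Fin m} :
    (gadgetGraph' Cl).Adj (.B i) (.cls j) ↔ i.val = 6 := by
  simp [gadgetGraph', gadgetRel']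

@[simp] theorem gadget_adj_H_var {i : Fin 7} {v : U} :
    (gadgetGraph' Cl).Adj (.H i) (.var v) ↔ i.val = 0 := by
  simp [gadgetGraph', gadgetRel']

@[simp] theorem gadget_adj_mid_cls {j : Fin (m - 1)} {i : Fin m} :
    (gadgetGraph' Cl).Adj (.mid j) (.cls i) ↔ i.val = j.val ∨ i.val = j.val + 1 := by
  simp [gadgetGraph', gadgetRel']

theorem gadget_connected (hCl : ∀ j, (Cl j).Nonempty) : (gadgetGraph' Cl).Connected := by
  have hH : ∀ (n : ℕ) (hn : n < 7),
      (gadgetGraph' Cl).Reachable (.H ⟨n, hn⟩) (.H 0) := by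
    intro n
    induction n with
    | zero => exact fun _ => .rfl
    | succ n ih =>
      intro hn
      have h1 : (gadgetGraph' Cl).Adj (.H ⟨n + 1, hn⟩) (.A ⟨n, by omega⟩) := by simp
      have h2 : (gadgetGraph' Cl).Adj (.A ⟨n, by omega⟩) (.H ⟨n, by omega⟩) := by
        simp [adj_comm _ (GV'.A _)]
      exact h1.reachable.trans (h2.reachable.trans (ih _))
  have hv : ∀ v, (gadgetGraph' Cl).Reachable (.var v) (.H 0) := fun v =>
    (Adj.reachable (by simp)).symm
  have hc : ∀ j, (gadgetGraph' Cl).Reachable (.cls j) (.H 0) := by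
    intro j
    obtain ⟨v, hvj⟩ := hCl j
    exact (Adj.reachable (gadget_adj_cls_var.2 hvj)).trans (hv v)
  have h : ∀ x, (gadgetGraph' Cl).Reachable x (.H 0) := by
    rintro (v | j | j | i | i | i)
    · exact hv v
    · exact hc j
    · refine Reachable.trans (Adj.reachable ?_) (hc ⟨j, by omega⟩)
      simp
    · exact (Adj.reachable (by simp : (gadgetGraph' Cl).Adj (.H i) (.A i))).symm.trans (hH i i.2)
    · exact (Adj.reachable (by simp : (gadgetGraph' Cl).Adj (.H i) (.B i))).symm.trans (hH i i.2)
    · exact hH i i.2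
  exact { preconnected := fun x y => (h x).trans (h y).symm, nonempty := ⟨.H 0⟩ }

/-- The colouring of the gadget graph given by a truth assignment. -/
def assignmentColoring (b : U → Bool) : GV' U m → Fin 3
  | .H _ => 0
  | .cls _ => 0
  | .A _ => 1
  | .B _ => 2
  | .mid _ => 1
  | .var v => if b v then 1 else 2

theorem gadget_adj_A_iff_B {x : GV' U m} {i : Fin 7} :
    (gadgetGraph' Cl).Adj x (.A i) ↔ (gadgetGraph' Cl).Adj x (.B i) := by
  rcases x with v | j | j | i' | i' | i' <;> simp [gadgetGraph', gadgetRel']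

theorem gadget_adj_var {x : GV' U m} {v : U} (h : (gadgetGraph' Cl).Adj x (.var v)) :
    x = .H 0 ∨ ∃ j, x = .cls j := by
  rcases x with v | j | j | i | i | i <;> simp_all [gadgetGraph', gadgetRel']

theorem gadget_adj_mid {x : GV' U m} {k : Fin (m - 1)} (h : (gadgetGraph' Cl).Adj x (.mid k)) :
    ∃ j, x = .cls j := by
  rcases x with v | j | j | i | i | i <;> simp_all [gadgetGraph', gadgetRel']

theorem assignmentColoring_bipartite (b : U → Bool) {x y : GV' U m}
    (h : (gadgetGraph' Cl).Adj x y) :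
    assignmentColoring b x = 0 ↔ assignmentColoring b y ≠ 0 := by
  have hvar : ∀ v, (if b v then (1 : Fin 3) else 2) ≠ 0 := by
    intro v
    split <;> decide
  rcases x with v | j | j | i | i | i <;> rcases y with v' | j' | j' | i' | i' | i' <;>
    simp_all [assignmentColoring, gadgetGraph', gadgetRel']

theorem assignmentColoring_isStrongCfvc (b : U → Bool)
    (hb : ∀ j, (∃ x ∈ Cl j, b x = true) ∧ (∃ y ∈ Cl j, b y = false)) :
    IsStrongCfvc (gadgetGraph' Cl) (assignmentColoring b) := by
  refine isStrongCfvc_of_swap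
    (gadget_connected fun j => let ⟨x, hx, _⟩ := (hb j).1; ⟨x, hx⟩)
    (fun x y => assignmentColoring_bipartite b) ?_
  intro x w y hx hxw hwy k hk
  have hk' : k = 1 ∨ k = 2 := by
    revert k
    decide
  -- `A i` and `B i` have the same neighbours and different nonzero colours.
  have hAB : ∀ {x y : GV' U m} (i : Fin 7),
      (gadgetGraph' Cl).Adj x (.A i) → (gadgetGraph' Cl).Adj y (.A i) →
      ∃ w, (gadgetGraph' Cl).Adj x w ∧ (gadgetGraph' Cl).Adj w y ∧
        assignmentColoring b w = k := by
    intro x y i h1 h2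
    rcases hk' with rfl | rfl
    · exact ⟨_, h1, h2.symm, rfl⟩
    · exact ⟨_, gadget_adj_A_iff_B.1 h1, (gadget_adj_A_iff_B.1 h2).symm, rfl⟩
  have hcc : ∀ j j' : Fin m, ∃ w, (gadgetGraph' Cl).Adj (.cls j) w ∧
      (gadgetGraph' Cl).Adj w (.cls j') ∧ assignmentColoring b w = k := fun j j' =>
    hAB 6 (gadget_adj_A_cls.2 rfl).symm (gadget_adj_A_cls.2 rfl).symm
  have hHc : ∀ j, ∃ w, (gadgetGraph' Cl).Adj (.H 0) w ∧
      (gadgetGraph' Cl).Adj w (.cls j) ∧ assignmentColoring b w = k := by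
    intro j
    obtain ⟨v, hv, hvk⟩ : ∃ v ∈ Cl j, assignmentColoring (m := m) b (.var v) = k := by
      rcases hk' with rfl | rfl
      · obtain ⟨v, hv, hbv⟩ := (hb j).1
        exact ⟨v, hv, by simp [assignmentColoring, hbv]⟩
      · obtain ⟨v, hv, hbv⟩ := (hb j).2
        exact ⟨v, hv, by simp [assignmentColoring, hbv]⟩
    exact ⟨.var v, gadget_adj_H_var.2 rfl, (gadget_adj_cls_var.2 hv).symm, hvk⟩
  rcases w with v | j | j | i | i | i
  · rcases gadget_adj_var hxw with rfl | ⟨j, rfl⟩ <;>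
      rcases gadget_adj_var hwy.symm with rfl | ⟨j', rfl⟩
    · exact hAB 0 (gadget_adj_H_A.2 (.inl rfl)) (gadget_adj_H_A.2 (.inl rfl))
    · exact hHc j'
    · obtain ⟨w, h1, h2, h3⟩ := hHc j
      exact ⟨w, h2.symm, h1.symm, h3⟩
    · exact hcc j j'
  · exact absurd rfl ((assignmentColoring_bipartite b hxw).1 hx)
  · obtain ⟨j, rfl⟩ := gadget_adj_mid hxw
    obtain ⟨j', rfl⟩ := gadget_adj_mid hwy.symm
    exact hcc j j'
  · exact hAB i hxw hwy.symm
  · exact hAB i (gadget_adj_A_iff_B.2 hxw) (gadget_adj_A_iff_B.2 hwy.symm)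
  · exact absurd rfl ((assignmentColoring_bipartite b hxw).1 hx)

/-- Some colour occurs exactly once in the list. -/
def UniqueColor (l : List (Fin 3)) : Prop :=
  (l.count 0 == 1 || l.count 1 == 1 || l.count 2 == 1) = true

instance : DecidablePred UniqueColor := fun _ => inferInstanceAs (Decidable (_ = true))

theorem uniqueColor_iff {l : List (Fin 3)} : UniqueColor l ↔ ∃ c, l.count c = 1 := by
  simp [UniqueColor, Fin.exists_fin_succ, or_assoc]

set_option synthInstance.maxHeartbeats 400000 in
set_option synthInstance.maxSize 2000 in
theorem ladder_colors : ∀ h₀ a₀ b₀ : Fin 3, h₀ ≠ a₀ → h₀ ≠ b₀ → ∀ h₁, h₁ ≠ a₀ → h₁ ≠ b₀ →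
    ∀ a₁ b₁, h₁ ≠ a₁ → h₁ ≠ b₁ →
    (∀ t, ∃ s, UniqueColor [h₀, cond s a₀ b₀, h₁, cond t a₁ b₁]) →
    ∀ h₂, h₂ ≠ a₁ → h₂ ≠ b₁ → ∀ a₂ b₂, h₂ ≠ a₂ → h₂ ≠ b₂ →
    (∀ t, ∃ s, UniqueColor [h₁, cond s a₁ b₁, h₂, cond t a₂ b₂]) →
    (∀ t, ∃ s s', UniqueColor [h₀, cond s a₀ b₀, h₁, cond s' a₁ b₁, h₂, cond t a₂ b₂]) →
    ∀ h₃, h₃ ≠ a₂ → h₃ ≠ b₂ →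
    (∀ t, ∃ s, UniqueColor [cond t a₁ b₁, h₂, cond s a₂ b₂, h₃]) →
    (∃ s s' s'', UniqueColor
      [h₀, cond s a₀ b₀, h₁, cond s' a₁ b₁, h₂, cond s'' a₂ b₂, h₃]) →
    ∀ a₃ b₃, h₃ ≠ a₃ → h₃ ≠ b₃ →
    (∀ t t', ∃ s s', UniqueColor
      [cond t a₀ b₀, h₁, cond s a₁ b₁, h₂, cond s' a₂ b₂, h₃, cond t' a₃ b₃]) →
    ∀ h₄, h₄ ≠ a₃ → h₄ ≠ b₃ →
    (∃ s s' s'', UniqueColor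
      [h₁, cond s a₁ b₁, h₂, cond s' a₂ b₂, h₃, cond s'' a₃ b₃, h₄]) →
    (∀ t, ∃ s s', UniqueColor [cond t a₁ b₁, h₂, cond s a₂ b₂, h₃, cond s' a₃ b₃, h₄]) →
    (∀ t, ∃ s, UniqueColor [cond t a₂ b₂, h₃, cond s a₃ b₃, h₄]) →
    h₁ = h₂ ∧ h₂ = h₃ ∧ a₁ ≠ b₁ ∧ a₂ ≠ b₂ ∧ (h₀ = h₁ → a₀ ≠ b₀) ∧ (h₄ = h₃ → a₃ ≠ b₃) := by
  decide +kernel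

/-! Colour constraints along ascending walks. Here `z` is the common colour of the inner vertices
`h_i` of the ladder, `h₀` and `h₆` are the colours of its two ends, and `c` and `v` those of a
clause vertex and of a variable vertex. -/

theorem clause_color_eq_start : ∀ h₀ z : Fin 3, h₀ ≠ z →
    ∀ a₀ b₀, h₀ ≠ a₀ → h₀ ≠ b₀ → z ≠ a₀ → z ≠ b₀ →
    ∀ a₁ b₁, z ≠ a₁ → z ≠ b₁ → a₁ ≠ b₁ → ∀ c,
    (∀ t, ∃ v s, h₀ ≠ v ∧ c ≠ v ∧ UniqueColor [c, v, h₀, cond s a₀ b₀, z, cond t a₁ b₁]) →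
    c = h₀ := by decide +kernel

theorem not_wrap_of_start_ne_of_end_eq : ∀ h₀ z : Fin 3, h₀ ≠ z →
    ∀ a₀ b₀, h₀ ≠ a₀ → h₀ ≠ b₀ → z ≠ a₀ → z ≠ b₀ →
    ∀ a₁ b₁, z ≠ a₁ → z ≠ b₁ → a₁ ≠ b₁ → ∀ a₆ b₆, z ≠ a₆ → z ≠ b₆ → h₀ ≠ a₆ → h₀ ≠ b₆ →
    ¬ (∀ t, ∃ s v s', h₀ ≠ v ∧
      UniqueColor [z, cond s a₆ b₆, h₀, v, h₀, cond s' a₀ b₀, z, cond t a₁ b₁]) := by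
  decide +kernel

theorem not_top_to_var_of_start_ne : ∀ h₀ z : Fin 3, h₀ ≠ z →
    ∀ a₀ b₀, h₀ ≠ a₀ → h₀ ≠ b₀ → z ≠ a₀ → z ≠ b₀ →
    ∀ a₄ b₄, z ≠ a₄ → z ≠ b₄ → a₄ ≠ b₄ → ∀ a₅ b₅, z ≠ a₅ → z ≠ b₅ → h₀ ≠ a₅ → h₀ ≠ b₅ →
    ∀ a₆ b₆, h₀ ≠ a₆ → h₀ ≠ b₆ →
    ∀ v, UniqueColor [h₀, v, h₀, a₀] → h₀ ≠ v →
    ¬ (∀ t, ∃ s s',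
      UniqueColor [cond t a₄ b₄, z, cond s a₅ b₅, h₀, cond s' a₆ b₆, h₀, v]) := by
  decide +kernel

theorem clause_color_eq_end : ∀ h₆ z : Fin 3, h₆ ≠ z →
    ∀ a₄ b₄, z ≠ a₄ → z ≠ b₄ → a₄ ≠ b₄ → ∀ a₅ b₅, z ≠ a₅ → z ≠ b₅ → h₆ ≠ a₅ → h₆ ≠ b₅ →
    ∀ a₆ b₆, h₆ ≠ a₆ → h₆ ≠ b₆ → ∀ c, c ≠ a₆ → c ≠ b₆ →
    (∀ t, ∃ s s', UniqueColor [cond t a₄ b₄, z, cond s a₅ b₅, h₆, cond s' a₆ b₆, c]) →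
    c = h₆ := by
  decide +kernel

set_option synthInstance.maxHeartbeats 400000 in
set_option synthInstance.maxSize 2000 in
theorem not_wrap_of_start_eq_of_end_ne : ∀ z h₆ : Fin 3, h₆ ≠ z → ∀ a₀ b₀, z ≠ a₀ → z ≠ b₀ →
    ∀ a₁ b₁, z ≠ a₁ → z ≠ b₁ → a₁ ≠ b₁ → ∀ a₆ b₆, h₆ ≠ a₆ → h₆ ≠ b₆ →
    ¬ (∀ t, ∃ s v s', h₆ ≠ v ∧ z ≠ v ∧
      UniqueColor [h₆, cond s a₆ b₆, h₆, v, z, cond s' a₀ b₀, z, cond t a₁ b₁]) := by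
  decide +kernel

theorem not_clause_to_start_of_color_eq :
    ∀ z a₀ b₀ : Fin 3, z ≠ a₀ → z ≠ b₀ → a₀ ≠ b₀ → ∀ v, z ≠ v →
    ¬ (∀ t, UniqueColor [z, v, z, cond t a₀ b₀]) := by
  decide +kernel

theorem not_end_to_clause_of_color_eq :
    ∀ z a₅ b₅ : Fin 3, z ≠ a₅ → z ≠ b₅ → a₅ ≠ b₅ → ∀ a₆, z ≠ a₆ →
    ¬ (∀ t, UniqueColor [cond t a₅ b₅, z, a₆, z]) := by
  decide +kernel

theorem not_wrap_of_start_eq_of_end_eq : ∀ z a₀ b₀ : Fin 3, z ≠ a₀ → z ≠ b₀ →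
    ∀ a₁ b₁, z ≠ a₁ → z ≠ b₁ → a₁ ≠ b₁ → ∀ a₆, z ≠ a₆ →
    ¬ (∀ t, ∃ c v s', c ≠ a₆ ∧ c ≠ z ∧ v ≠ z ∧ c ≠ v ∧
      UniqueColor [z, a₆, c, v, z, cond s' a₀ b₀, z, cond t a₁ b₁]) := by
  decide +kernel

/-- Position of a vertex on the cycle of length `16` onto which the gadget graph folds. -/
def gadgetLevel : GV' U m → ℕ
  | .H i => 2 * i.val
  | .A i => 2 * i.val + 1
  | .B i => 2 * i.val + 1
  | .cls _ => 14
  | .var _ => 15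
  | .mid _ => 15

theorem gadgetLevel_H (i : Fin 7) : gadgetLevel (.H i : GV' U m) = 2 * i.val := rfl

theorem gadgetLevel_cls (j : Fin m) : gadgetLevel (.cls j : GV' U m) = 14 := rfl

theorem gadgetLevel_var (v : U) : gadgetLevel (.var v : GV' U m) = 15 := rfl

theorem gadgetLevel_adj {x y : GV' U m} (h : (gadgetGraph' Cl).Adj x y) :
    (gadgetLevel x + 1) % 16 = gadgetLevel y % 16 ∨
      (gadgetLevel y + 1) % 16 = gadgetLevel x % 16 := by
  rcases x with v | j | j | i | i | i <;> rcases y with v' | j' | j' | i' | i' | i' <;>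
    simp [gadgetGraph', gadgetRel'] at h <;> simp [gadgetLevel] <;> omega

theorem exists_gadgetLevel_add_eq {s t : GV' U m} (p : (gadgetGraph' Cl).Walk s t) :
    ∃ k ≤ p.length, (gadgetLevel t + 2 * k) % 16 = (gadgetLevel s + p.length) % 16 := by
  induction p with
  | nil => exact ⟨0, by simp⟩
  | cons h q ih =>
    obtain ⟨k, hk, hk'⟩ := ih
    rw [Walk.length_cons]
    rcases gadgetLevel_adj h with h | h
    · exact ⟨k, by omega, by omega⟩
    · exact ⟨k + 1, by omega, by omega⟩

/-- `l` is the list of colours along a walk of length `n` from `s` to `t` each step of which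
increases the level by one. -/
def IsAscent (Cl : Fin m → Finset U) (f : GV' U m → Fin 3) :
    ℕ → GV' U m → GV' U m → List (Fin 3) → Prop
  | 0, s, t, l => s = t ∧ l = [f s]
  | n + 1, s, t, l => ∃ x l', (gadgetGraph' Cl).Adj s x ∧
      (gadgetLevel s + 1) % 16 = gadgetLevel x % 16 ∧ IsAscent Cl f n x t l' ∧ l = f s :: l'

theorem isAscent_support (f : GV' U m → Fin 3) {s t : GV' U m}
    (p : (gadgetGraph' Cl).Walk s t) {n : ℕ} (hp : p.length ≤ n) (hn : n ≤ 7)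
    (hL : (gadgetLevel s + n) % 16 = gadgetLevel t % 16) :
    IsAscent Cl f n s t (p.support.map f) := by
  induction p generalizing n with
  | nil =>
    obtain rfl : n = 0 := by omega
    exact ⟨rfl, rfl⟩
  | @cons s x t h q ih =>
    rw [Walk.length_cons] at hp
    obtain ⟨n, rfl⟩ := Nat.exists_eq_add_of_le' (Nat.one_le_of_lt hp)
    rcases gadgetLevel_adj h with h' | h'
    · exact ⟨x, _, h, h', ih (by omega) (by omega) (by omega), by simp⟩
    · obtain ⟨k, hk, hk'⟩ := exists_gadgetLevel_add_eq q
      omega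

variable {f : GV' U m → Fin 3} {s t : GV' U m} {n : ℕ} {l : List (Fin 3)}

theorem exists_isAscent_uniqueColor (hf : IsStrongCfvc (gadgetGraph' Cl) f)
    (p : (gadgetGraph' Cl).Walk s t) (hp : p.length = n) (h0 : 0 < n) (hn : n ≤ 7)
    (hL : (gadgetLevel s + n) % 16 = gadgetLevel t % 16) :
    ∃ l, IsAscent Cl f n s t l ∧ UniqueColor l := by
  classical
  have hst : s ≠ t := by
    rintro rfl
    omega
  obtain ⟨q, hq, hlen, c, x, ⟨hx, hxc⟩, huniq⟩ := hf s t hst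
  refine ⟨q.support.map f, isAscent_support f q ?_ hn hL, uniqueColor_iff.2 ⟨c, ?_⟩⟩
  · rw [hlen, ← hp]
    exact dist_le p
  · rw [List.count, List.countP_map, ← List.count_eq_one_of_mem hq.support_nodup hx, List.count]
    refine List.countP_congr fun y hy => ?_
    simp only [Function.comp_apply, beq_iff_eq]
    exact ⟨fun h => huniq y ⟨hy, h⟩, fun h => h ▸ hxc⟩

theorem IsStrongCfvc.color_ne (hf : IsStrongCfvc (gadgetGraph' Cl) f)
    (h : (gadgetGraph' Cl).Adj s t) : f s ≠ f t := by
  intro heq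
  obtain ⟨q, hq, hlen, c, x, ⟨hx, hxc⟩, huniq⟩ := hf s t h.ne
  rw [dist_eq_one_iff_adj.2 h] at hlen
  match q with
  | .cons _ .nil =>
    simp only [Walk.support_cons, Walk.support_nil, List.mem_cons, List.not_mem_nil,
      or_false] at hx huniq
    have h1 : f s = c := by
      rcases hx with rfl | rfl
      · exact hxc
      · exact heq.trans hxc
    exact h.ne ((huniq s ⟨.inl rfl, h1⟩).trans (huniq t ⟨.inr rfl, heq ▸ h1⟩).symm)
  | .nil => simp at hlen
  | .cons _ (.cons _ _) => simp at hlen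

/-- The vertices `A i` and `B i`, uniformly. -/
def rung (s : Bool) (i : Fin 7) : GV' U m := cond s (.A i) (.B i)

theorem color_rung (f : GV' U m → Fin 3) (s : Bool) (i : Fin 7) :
    f (rung s i) = cond s (f (.A i)) (f (.B i)) := by
  cases s <;> rfl

theorem gadgetLevel_rung (s : Bool) (i : Fin 7) :
    gadgetLevel (rung s i : GV' U m) = 2 * i.val + 1 := by
  cases s <;> rfl

theorem adj_H_rung (s : Bool) (i : Fin 7) : (gadgetGraph' Cl).Adj (.H i) (rung s i) := by
  cases s <;> simp [rung]

theorem adj_rung_H (s : Bool) {i j : Fin 7} (h : j.val = i.val + 1) :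
    (gadgetGraph' Cl).Adj (rung s i) (.H j) := by
  cases s <;> simp [rung, adj_comm _ _ (GV'.H j), h]

theorem adj_rung_cls (s : Bool) (j : Fin m) : (gadgetGraph' Cl).Adj (rung s 6) (.cls j) := by
  cases s <;> simp [rung]

theorem adj_var_H (v : U) : (gadgetGraph' Cl).Adj (.var v) (.H 0) :=
  (gadget_adj_H_var.2 rfl).symm

namespace IsAscent

theorem of_one (h : IsAscent Cl f 1 s t l) : (gadgetGraph' Cl).Adj s t ∧ l = [f s, f t] := by
  obtain ⟨x, l', h, -, ⟨rfl, rfl⟩, rfl⟩ := h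
  exact ⟨h, rfl⟩

theorem of_H {i : Fin 7} (h : IsAscent Cl f (n + 1) (.H i) t l) :
    ∃ s l', IsAscent Cl f n (rung s i) t l' ∧ l = f (.H i) :: l' := by
  obtain ⟨x, l', h, hL, h', rfl⟩ := h
  rcases x with v | j | j | i' | i' | i' <;> simp only [gadgetLevel] at hL
  · omega
  · simp [gadgetGraph', gadgetRel'] at h
  · simp [gadgetGraph', gadgetRel'] at h
  · obtain rfl : i' = i := by omega
    exact ⟨true, l', h', rfl⟩
  · obtain rfl : i' = i := by omega
    exact ⟨false, l', h', rfl⟩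
  · omega

theorem of_rung {b : Bool} {i j : Fin 7} (hij : j.val = i.val + 1)
    (h : IsAscent Cl f (n + 1) (rung b i) t l) :
    ∃ l', IsAscent Cl f n (.H j) t l' ∧ l = cond b (f (.A i)) (f (.B i)) :: l' := by
  obtain ⟨x, l', h, hL, h', rfl⟩ := h
  rw [gadgetLevel_rung] at hL
  rw [color_rung f]
  rcases x with v | j' | j' | i' | i' | i' <;> simp only [gadgetLevel] at hL
  · cases b <;> simp [rung, gadgetGraph', gadgetRel'] at h
  · cases b <;> simp [rung, gadgetGraph', gadgetRel'] at h <;> omega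
  · cases b <;> simp [rung, gadgetGraph', gadgetRel'] at h
  · omega
  · omega
  · obtain rfl : i' = j := by omega
    exact ⟨l', h', rfl⟩

theorem of_rung_last {b : Bool} (h : IsAscent Cl f (n + 1) (rung b 6) t l) :
    ∃ j l', IsAscent Cl f n (.cls j) t l' ∧ l = cond b (f (.A 6)) (f (.B 6)) :: l' := by
  obtain ⟨x, l', h, hL, h', rfl⟩ := h
  rw [gadgetLevel_rung] at hL
  rw [color_rung f]
  rcases x with v | j' | j' | i' | i' | i' <;> simp only [gadgetLevel] at hL
  · cases b <;> simp [rung, gadgetGraph', gadgetRel'] at h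
  · exact ⟨j', l', h', rfl⟩
  · cases b <;> simp [rung, gadgetGraph', gadgetRel'] at h
  all_goals omega

theorem of_cls {j : Fin m} (h : IsAscent Cl f (n + 2) (.cls j) t l) :
    ∃ v ∈ Cl j, ∃ l', IsAscent Cl f n (.H 0) t l' ∧ l = f (.cls j) :: f (.var v) :: l' := by
  obtain ⟨x, l', h, hL, ⟨y, l'', h', hL', h'', rfl⟩, rfl⟩ := h
  rcases x with v | j' | j' | i' | i' | i' <;> simp only [gadgetLevel] at hL hL'
  · refine ⟨v, gadget_adj_cls_var.1 h, l'', ?_, rfl⟩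
    rcases gadget_adj_var h'.symm with rfl | ⟨j', rfl⟩
    · exact h''
    · simp at hL'
  · omega
  · obtain ⟨j'', rfl⟩ := gadget_adj_mid h'.symm
    simp at hL'
  all_goals omega

end IsAscent

/-- On five consecutive rungs of the ladder, the three inner vertices `h_i` have the same colour. -/
theorem ladder_structure (hf : IsStrongCfvc (gadgetGraph' Cl) f) {i₀ i₁ i₂ i₃ i₄ : Fin 7}
    (h₁ : i₁.val = i₀.val + 1) (h₂ : i₂.val = i₁.val + 1) (h₃ : i₃.val = i₂.val + 1)
    (h₄ : i₄.val = i₃.val + 1) :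
    f (.H i₁) = f (.H i₂) ∧ f (.H i₂) = f (.H i₃) ∧ f (.A i₁) ≠ f (.B i₁) ∧
      f (.A i₂) ≠ f (.B i₂) ∧ (f (.H i₀) = f (.H i₁) → f (.A i₀) ≠ f (.B i₀)) ∧
      (f (.H i₄) = f (.H i₃) → f (.A i₃) ≠ f (.B i₃)) := by
  have hA : ∀ i, f (.H i) ≠ f (.A i) := fun i => hf.color_ne (adj_H_rung true i)
  have hB : ∀ i, f (.H i) ≠ f (.B i) := fun i => hf.color_ne (adj_H_rung false i)
  have hA' : ∀ {i j : Fin 7}, j.val = i.val + 1 → f (.H j) ≠ f (.A i) := fun h =>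
    (hf.color_ne (adj_rung_H true h)).symm
  have hB' : ∀ {i j : Fin 7}, j.val = i.val + 1 → f (.H j) ≠ f (.B i) := fun h =>
    (hf.color_ne (adj_rung_H false h)).symm
  have w₃ : ∀ {i j : Fin 7}, j.val = i.val + 1 → ∀ t, ∃ s, UniqueColor
      [f (.H i), cond s (f (.A i)) (f (.B i)), f (.H j), cond t (f (.A j)) (f (.B j))] := by
    intro i j h t
    obtain ⟨l, hl₁, hu⟩ := exists_isAscent_uniqueColor (n := 3) hf
      (.cons (adj_H_rung true i) (.cons (adj_rung_H true h) (.cons (adj_H_rung t j) .nil))) rfl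
      (by simp) (by simp) (by simp only [gadgetLevel_H, gadgetLevel_rung]; omega)
    obtain ⟨s, _, hl₂, rfl⟩ := hl₁.of_H
    obtain ⟨_, hl₃, rfl⟩ := hl₂.of_rung h
    obtain ⟨-, rfl⟩ := hl₃.of_one
    exact ⟨s, by simpa only [color_rung] using hu⟩
  have w₃' : ∀ {i j k : Fin 7}, j.val = i.val + 1 → k.val = j.val + 1 → ∀ t, ∃ s, UniqueColor
      [cond t (f (.A i)) (f (.B i)), f (.H j), cond s (f (.A j)) (f (.B j)), f (.H k)] := by
    intro i j k h h' t
    obtain ⟨l, hl₁, hu⟩ := exists_isAscent_uniqueColor (n := 3) hf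
      (.cons (adj_rung_H t h) (.cons (adj_H_rung true j) (.cons (adj_rung_H true h') .nil))) rfl
      (by simp) (by simp) (by simp only [gadgetLevel_H, gadgetLevel_rung]; omega)
    obtain ⟨_, hl₂, rfl⟩ := hl₁.of_rung h
    obtain ⟨s, _, hl₃, rfl⟩ := hl₂.of_H
    obtain ⟨-, rfl⟩ := hl₃.of_one
    exact ⟨s, by simpa only [color_rung] using hu⟩
  have w₅ : ∀ {i j k : Fin 7}, j.val = i.val + 1 → k.val = j.val + 1 → ∀ t, ∃ s s', UniqueColor
      [f (.H i), cond s (f (.A i)) (f (.B i)), f (.H j), cond s' (f (.A j)) (f (.B j)),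
        f (.H k), cond t (f (.A k)) (f (.B k))] := by
    intro i j k h h' t
    obtain ⟨l, hl₁, hu⟩ := exists_isAscent_uniqueColor (n := 5) hf
      (.cons (adj_H_rung true i) (.cons (adj_rung_H true h) (.cons (adj_H_rung true j)
        (.cons (adj_rung_H true h') (.cons (adj_H_rung t k) .nil))))) rfl
      (by simp) (by simp) (by simp only [gadgetLevel_H, gadgetLevel_rung]; omega)
    obtain ⟨s, _, hl₂, rfl⟩ := hl₁.of_H
    obtain ⟨_, hl₃, rfl⟩ := hl₂.of_rung h
    obtain ⟨s', _, hl₄, rfl⟩ := hl₃.of_H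
    obtain ⟨_, hl₅, rfl⟩ := hl₄.of_rung h'
    obtain ⟨-, rfl⟩ := hl₅.of_one
    exact ⟨s, s', by simpa only [color_rung] using hu⟩
  have w₅' : ∀ {i j k r : Fin 7}, j.val = i.val + 1 → k.val = j.val + 1 → r.val = k.val + 1 →
      ∀ t, ∃ s s', UniqueColor
      [cond t (f (.A i)) (f (.B i)), f (.H j), cond s (f (.A j)) (f (.B j)), f (.H k),
        cond s' (f (.A k)) (f (.B k)), f (.H r)] := by
    intro i j k r h h' h'' t
    obtain ⟨l, hl₁, hu⟩ := exists_isAscent_uniqueColor (n := 5) hf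
      (.cons (adj_rung_H t h) (.cons (adj_H_rung true j) (.cons (adj_rung_H true h')
        (.cons (adj_H_rung true k) (.cons (adj_rung_H true h'') .nil))))) rfl
      (by simp) (by simp) (by simp only [gadgetLevel_H, gadgetLevel_rung]; omega)
    obtain ⟨_, hl₂, rfl⟩ := hl₁.of_rung h
    obtain ⟨s, _, hl₃, rfl⟩ := hl₂.of_H
    obtain ⟨_, hl₄, rfl⟩ := hl₃.of_rung h'
    obtain ⟨s', _, hl₅, rfl⟩ := hl₄.of_H
    obtain ⟨-, rfl⟩ := hl₅.of_one
    exact ⟨s, s', by simpa only [color_rung] using hu⟩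
  have w₆ : ∀ {i j k r : Fin 7}, j.val = i.val + 1 → k.val = j.val + 1 → r.val = k.val + 1 →
      ∃ s s' s'', UniqueColor
      [f (.H i), cond s (f (.A i)) (f (.B i)), f (.H j), cond s' (f (.A j)) (f (.B j)),
        f (.H k), cond s'' (f (.A k)) (f (.B k)), f (.H r)] := by
    intro i j k r h h' h''
    obtain ⟨l, hl₁, hu⟩ := exists_isAscent_uniqueColor (n := 6) hf
      (.cons (adj_H_rung true i) (.cons (adj_rung_H true h) (.cons (adj_H_rung true j)
        (.cons (adj_rung_H true h') (.cons (adj_H_rung true k)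
          (.cons (adj_rung_H true h'') .nil)))))) rfl
      (by simp) (by simp) (by simp only [gadgetLevel_H]; omega)
    obtain ⟨s, _, hl₂, rfl⟩ := hl₁.of_H
    obtain ⟨_, hl₃, rfl⟩ := hl₂.of_rung h
    obtain ⟨s', _, hl₄, rfl⟩ := hl₃.of_H
    obtain ⟨_, hl₅, rfl⟩ := hl₄.of_rung h'
    obtain ⟨s'', _, hl₆, rfl⟩ := hl₅.of_H
    obtain ⟨-, rfl⟩ := hl₆.of_one
    exact ⟨s, s', s'', by simpa only [color_rung] using hu⟩
  have w₆' : ∀ {i j k r : Fin 7}, j.val = i.val + 1 → k.val = j.val + 1 → r.val = k.val + 1 →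
      ∀ t t', ∃ s s', UniqueColor
      [cond t (f (.A i)) (f (.B i)), f (.H j), cond s (f (.A j)) (f (.B j)),
        f (.H k), cond s' (f (.A k)) (f (.B k)), f (.H r), cond t' (f (.A r)) (f (.B r))] := by
    intro i j k r h h' h'' t t'
    obtain ⟨l, hl₁, hu⟩ := exists_isAscent_uniqueColor (n := 6) hf
      (.cons (adj_rung_H t h) (.cons (adj_H_rung true j) (.cons (adj_rung_H true h')
        (.cons (adj_H_rung true k) (.cons (adj_rung_H true h'') (.cons (adj_H_rung t' r) .nil))))))
      rfl
      (by simp) (by simp) (by simp only [gadgetLevel_rung]; omega)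
    obtain ⟨_, hl₂, rfl⟩ := hl₁.of_rung h
    obtain ⟨s, _, hl₃, rfl⟩ := hl₂.of_H
    obtain ⟨_, hl₄, rfl⟩ := hl₃.of_rung h'
    obtain ⟨s', _, hl₅, rfl⟩ := hl₄.of_H
    obtain ⟨_, hl₆, rfl⟩ := hl₅.of_rung h''
    obtain ⟨-, rfl⟩ := hl₆.of_one
    exact ⟨s, s', by simpa only [color_rung] using hu⟩
  exact ladder_colors _ _ _ (hA i₀) (hB i₀) _ (hA' h₁) (hB' h₁) _ _ (hA i₁) (hB i₁) (w₃ h₁)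
    _ (hA' h₂) (hB' h₂) _ _ (hA i₂) (hB i₂) (w₃ h₂) (w₅ h₁ h₂)
    _ (hA' h₃) (hB' h₃) (w₃' h₂ h₃) (w₆ h₁ h₂ h₃) _ _ (hA i₃) (hB i₃) (w₆' h₁ h₂ h₃)
    _ (hA' h₄) (hB' h₄) (w₆ h₂ h₃ h₄) (w₅' h₂ h₃ h₄) (w₃' h₃ h₄)

/-- A strong conflict-free vertex-connection 3-colouring is not constant on any clause. -/
theorem exists_color_var_ne (hf : IsStrongCfvc (gadgetGraph' Cl) f)
    (hCl : ∀ j, (Cl j).Nonempty) (j₀ : Fin m) (κ : Fin 3) :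
    ∃ v ∈ Cl j₀, f (.var v) ≠ κ := by
  by_contra! hκ
  have hA : ∀ i, f (.H i) ≠ f (.A i) := fun i => hf.color_ne (adj_H_rung true i)
  have hB : ∀ i, f (.H i) ≠ f (.B i) := fun i => hf.color_ne (adj_H_rung false i)
  have hA' : ∀ {i j : Fin 7}, j.val = i.val + 1 → f (.H j) ≠ f (.A i) := fun h =>
    (hf.color_ne (adj_rung_H true h)).symm
  have hB' : ∀ {i j : Fin 7}, j.val = i.val + 1 → f (.H j) ≠ f (.B i) := fun h =>
    (hf.color_ne (adj_rung_H false h)).symm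
  have hcA : ∀ j, f (.cls j) ≠ f (.A 6) := fun j => (hf.color_ne (adj_rung_cls true j)).symm
  have hcB : ∀ j, f (.cls j) ≠ f (.B 6) := fun j => (hf.color_ne (adj_rung_cls false j)).symm
  have hvH : ∀ v, f (.H 0) ≠ f (.var v) := fun v => (hf.color_ne (adj_var_H v)).symm
  have hvc : ∀ j, ∀ v ∈ Cl j, f (.cls j) ≠ f (.var v) := fun j v hv =>
    hf.color_ne (gadget_adj_cls_var.2 hv)
  have w₁ : ∀ j t, ∃ v ∈ Cl j, UniqueColor
      [f (.cls j), f (.var v), f (.H 0), cond t (f (.A 0)) (f (.B 0))] := by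
    intro j t
    obtain ⟨v, hv⟩ := hCl j
    obtain ⟨l, hl₁, hu⟩ := exists_isAscent_uniqueColor (n := 3) hf
      (.cons (gadget_adj_cls_var.2 hv) (.cons (adj_var_H v) (.cons (adj_H_rung t 0) .nil))) rfl
      (by simp) (by simp) (by simp [gadgetLevel_cls, gadgetLevel_rung])
    obtain ⟨v, hv, _, hl₂, rfl⟩ := hl₁.of_cls
    obtain ⟨-, rfl⟩ := hl₂.of_one
    exact ⟨v, hv, by simpa only [color_rung] using hu⟩
  have w₂ : ∀ j t, ∃ v ∈ Cl j, ∃ s, UniqueColor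
      [f (.cls j), f (.var v), f (.H 0), cond s (f (.A 0)) (f (.B 0)), f (.H 1),
        cond t (f (.A 1)) (f (.B 1))] := by
    intro j t
    obtain ⟨v, hv⟩ := hCl j
    obtain ⟨l, hl₁, hu⟩ := exists_isAscent_uniqueColor (n := 5) hf
      (.cons (gadget_adj_cls_var.2 hv) (.cons (adj_var_H v) (.cons (adj_H_rung true 0)
        (.cons (adj_rung_H true (j := 1) rfl) (.cons (adj_H_rung t 1) .nil))))) rfl
      (by simp) (by simp) (by simp [gadgetLevel_cls, gadgetLevel_rung])
    obtain ⟨v, hv, _, hl₂, rfl⟩ := hl₁.of_cls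
    obtain ⟨s, _, hl₃, rfl⟩ := hl₂.of_H
    obtain ⟨_, hl₄, rfl⟩ := hl₃.of_rung (j := 1) rfl
    obtain ⟨-, rfl⟩ := hl₄.of_one
    exact ⟨v, hv, s, by simpa only [color_rung] using hu⟩
  have w₃ : ∀ j t, ∃ s, UniqueColor
      [cond t (f (.A 5)) (f (.B 5)), f (.H 6), cond s (f (.A 6)) (f (.B 6)), f (.cls j)] := by
    intro j t
    obtain ⟨l, hl₁, hu⟩ := exists_isAscent_uniqueColor (n := 3) hf
      (.cons (adj_rung_H t (i := 5) (j := 6) rfl) (.cons (adj_H_rung true 6)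
        (.cons (adj_rung_cls true j) .nil))) rfl
      (by simp) (by simp) (by simp [gadgetLevel_cls, gadgetLevel_rung])
    obtain ⟨_, hl₂, rfl⟩ := hl₁.of_rung (j := 6) rfl
    obtain ⟨s, _, hl₃, rfl⟩ := hl₂.of_H
    obtain ⟨-, rfl⟩ := hl₃.of_one
    exact ⟨s, by simpa only [color_rung] using hu⟩
  have w₄ : ∀ j t, ∃ s s', UniqueColor
      [cond t (f (.A 4)) (f (.B 4)), f (.H 5), cond s (f (.A 5)) (f (.B 5)), f (.H 6),
        cond s' (f (.A 6)) (f (.B 6)), f (.cls j)] := by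
    intro j t
    obtain ⟨l, hl₁, hu⟩ := exists_isAscent_uniqueColor (n := 5) hf
      (.cons (adj_rung_H t (i := 4) (j := 5) rfl) (.cons (adj_H_rung true 5)
        (.cons (adj_rung_H true (j := 6) rfl) (.cons (adj_H_rung true 6)
          (.cons (adj_rung_cls true j) .nil))))) rfl
      (by simp) (by simp) (by simp [gadgetLevel_cls, gadgetLevel_rung])
    obtain ⟨_, hl₂, rfl⟩ := hl₁.of_rung (j := 5) rfl
    obtain ⟨s, _, hl₃, rfl⟩ := hl₂.of_H
    obtain ⟨_, hl₄, rfl⟩ := hl₃.of_rung (j := 6) rfl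
    obtain ⟨s', _, hl₅, rfl⟩ := hl₄.of_H
    obtain ⟨-, rfl⟩ := hl₅.of_one
    exact ⟨s, s', by simpa only [color_rung] using hu⟩
  have w₅ : ∀ j, ∀ v ∈ Cl j, ∀ t, ∃ s s' k, UniqueColor
      [cond t (f (.A 4)) (f (.B 4)), f (.H 5), cond s (f (.A 5)) (f (.B 5)), f (.H 6),
        cond s' (f (.A 6)) (f (.B 6)), f (.cls k), f (.var v)] := by
    intro j v hv t
    obtain ⟨l, hl₁, hu⟩ := exists_isAscent_uniqueColor (n := 6) hf
      (.cons (adj_rung_H t (i := 4) (j := 5) rfl) (.cons (adj_H_rung true 5)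
        (.cons (adj_rung_H true (j := 6) rfl) (.cons (adj_H_rung true 6)
          (.cons (adj_rung_cls true j) (.cons (gadget_adj_cls_var.2 hv) .nil)))))) rfl
      (by simp) (by simp) (by simp [gadgetLevel_var, gadgetLevel_rung])
    obtain ⟨_, hl₂, rfl⟩ := hl₁.of_rung (j := 5) rfl
    obtain ⟨s, _, hl₃, rfl⟩ := hl₂.of_H
    obtain ⟨_, hl₄, rfl⟩ := hl₃.of_rung (j := 6) rfl
    obtain ⟨s', _, hl₅, rfl⟩ := hl₄.of_H
    obtain ⟨k, _, hl₆, rfl⟩ := hl₅.of_rung_last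
    obtain ⟨-, rfl⟩ := hl₆.of_one
    exact ⟨s, s', k, hu⟩
  have w₆ : ∀ t, ∃ s j, ∃ v ∈ Cl j, ∃ s', UniqueColor
      [f (.H 6), cond s (f (.A 6)) (f (.B 6)), f (.cls j), f (.var v), f (.H 0),
        cond s' (f (.A 0)) (f (.B 0)), f (.H 1), cond t (f (.A 1)) (f (.B 1))] := by
    intro t
    obtain ⟨v, hv⟩ := hCl j₀
    obtain ⟨l, hl₁, hu⟩ := exists_isAscent_uniqueColor (n := 7) hf
      (.cons (adj_H_rung true 6) (.cons (adj_rung_cls true j₀)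
        (.cons (gadget_adj_cls_var.2 hv) (.cons (adj_var_H v) (.cons (adj_H_rung true 0)
        (.cons (adj_rung_H true (j := 1) rfl) (.cons (adj_H_rung t 1) .nil))))))) rfl
      (by simp) (by simp) (by simp [gadgetLevel_H, gadgetLevel_rung])
    obtain ⟨s, _, hl₂, rfl⟩ := hl₁.of_H
    obtain ⟨j, _, hl₃, rfl⟩ := hl₂.of_rung_last
    obtain ⟨v, hv, _, hl₄, rfl⟩ := hl₃.of_cls
    obtain ⟨s', _, hl₅, rfl⟩ := hl₄.of_H
    obtain ⟨_, hl₆, rfl⟩ := hl₅.of_rung (j := 1) rfl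
    obtain ⟨-, rfl⟩ := hl₆.of_one
    exact ⟨s, j, v, hv, s', by simpa only [color_rung] using hu⟩
  obtain ⟨h₁₂, h₂₃, full₁, -, full₀, -⟩ :=
    ladder_structure hf (i₀ := 0) (i₁ := 1) (i₂ := 2) (i₃ := 3) (i₄ := 4) rfl rfl rfl rfl
  obtain ⟨h₃₄, h₄₅, -, full₄, -, full₅⟩ :=
    ladder_structure hf (i₀ := 2) (i₁ := 3) (i₂ := 4) (i₃ := 5) (i₄ := 6) rfl rfl rfl rfl
  have h₁₅ : f (.H 5) = f (.H 1) := by rw [h₁₂, h₂₃, h₃₄, h₄₅]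
  have hA₁ := hA' (i := 0) (j := 1) rfl
  have hB₁ := hB' (i := 0) (j := 1) rfl
  have hA₄ := h₁₅ ▸ hA' (i := 4) (j := 5) rfl
  have hB₄ := h₁₅ ▸ hB' (i := 4) (j := 5) rfl
  have hA₅ := h₁₅ ▸ hA 5
  have hB₅ := h₁₅ ▸ hB 5
  have hA₆ := hA' (i := 5) (j := 6) rfl
  have hB₆ := hB' (i := 5) (j := 6) rfl
  rw [h₁₅] at full₅
  simp only [h₁₅] at w₄ w₅
  have hA₁' := hA 1
  have hB₁' := hB 1
  by_cases h₀ : f (.H 0) = f (.H 1)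
  · have full₀ := full₀ h₀
    simp only [← h₀] at hA₁ hB₁ hA₄ hB₄ hA₅ hB₅ hA₁' hB₁' full₅ w₄ w₆
    by_cases h₆ : f (.H 6) = f (.H 0)
    · have full₅ := full₅ h₆
      have hA₆' := hA 6
      have hB₆' := hB 6
      simp only [h₆] at hA₆' hB₆' w₃ w₆
      by_cases heq : f (.A 6) = f (.B 6)
      · simp only [← heq, Bool.cond_self] at w₃ w₆
        have hc : ∀ j, f (.cls j) ≠ f (.H 0) := fun j hj =>
          not_end_to_clause_of_color_eq _ _ _ hA₅ hB₅ full₅ _ hA₆' fun t => by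
            obtain ⟨_, hu⟩ := w₃ j t
            rwa [hj] at hu
        refine not_wrap_of_start_eq_of_end_eq _ _ _ (hA 0) (hB 0) _ _ hA₁' hB₁' full₁ _ hA₆'
          fun t => ?_
        obtain ⟨_, j, v, hv, s', hu⟩ := w₆ t
        exact ⟨_, _, s', hcA j, hc j, (hvH v).symm, hvc j v hv, hu⟩
      · have hc : f (.cls j₀) = f (.H 0) := by
          have hcA := hcA j₀
          have hcB := hcB j₀
          omega
        obtain ⟨v, hv⟩ := hCl j₀
        refine not_clause_to_start_of_color_eq _ _ _ (hA 0) (hB 0) full₀ _ (hvH v) fun t => ?_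
        obtain ⟨v', hv', hu⟩ := w₁ j₀ t
        rwa [hκ v' hv', ← hκ v hv, hc] at hu
    · have hc : ∀ j, f (.cls j) = f (.H 6) := fun j =>
        clause_color_eq_end _ _ h₆ _ _ hA₄ hB₄ full₄ _ _ hA₅ hB₅ hA₆ hB₆ _ _ (hA 6) (hB 6) _
          (hcA j) (hcB j) (w₄ j)
      refine not_wrap_of_start_eq_of_end_ne _ _ h₆ _ _ hA₁ hB₁ _ _ hA₁' hB₁' full₁ _ _ (hA 6) (hB 6)
        fun t => ?_
      obtain ⟨s, j, v, hv, s', hu⟩ := w₆ t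
      exact ⟨s, _, s', hc j ▸ hvc j v hv, hvH v, by rwa [hc j] at hu⟩
  · have hc : ∀ j, f (.cls j) = f (.H 0) := fun j =>
      clause_color_eq_start _ _ h₀ _ _ (hA 0) (hB 0) hA₁ hB₁ _ _ hA₁' hB₁' full₁ _ fun t =>
        let ⟨v, hv, s, hu⟩ := w₂ j t
        ⟨_, s, hvH v, hvc j v hv, hu⟩
    have hcA := hc j₀ ▸ hcA j₀
    have hcB := hc j₀ ▸ hcB j₀
    simp only [hc] at w₁ w₄ w₅ w₆
    by_cases h₆ : f (.H 6) = f (.H 1)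
    · have hA₆' := hA 6
      have hB₆' := hB 6
      simp only [h₆] at hA₆' hB₆' w₆
      refine not_wrap_of_start_ne_of_end_eq _ _ h₀ _ _ (hA 0) (hB 0) hA₁ hB₁ _ _ hA₁' hB₁' full₁ _ _
        hA₆' hB₆' hcA hcB fun t => ?_
      obtain ⟨s, _, v, -, s', hu⟩ := w₆ t
      exact ⟨s, _, s', hvH v, hu⟩
    · have h₆' : f (.H 0) = f (.H 6) :=
        clause_color_eq_end _ _ h₆ _ _ hA₄ hB₄ full₄ _ _ hA₅ hB₅ hA₆ hB₆ _ _ (hA 6) (hB 6)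
          _ hcA hcB (w₄ j₀)
      simp only [← h₆'] at hA₆ hB₆ w₅
      obtain ⟨v, hv, hu⟩ := w₁ j₀ true
      refine not_top_to_var_of_start_ne _ _ h₀ _ _ (hA 0) (hB 0) hA₁ hB₁ _ _ hA₄ hB₄ full₄ _ _
        hA₅ hB₅ hA₆ hB₆ _ _ hcA hcB _ hu (hvH v) fun t => ?_
      obtain ⟨s, s', _, hu⟩ := w₅ j₀ v hv t
      exact ⟨s, s', hu⟩

end gadget

/-- for an enumerated nonempty collection `C_1, ..., C_m` of clauses
over a nonempty variable set `U`, each of size at least 2, `(U, 𝒞)` admits an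
NAE-assignment if and only if the modified gadget graph `G'(U, 𝒞)` is strongly
conflict-free vertex-connection 3-colorable. -/
theorem nae_iff_gadget'_strongCfvc_three_colorable {U : Type} [Fintype U] [Nonempty U]
    (m : ℕ) (hm : 1 ≤ m) (Cl : Fin m → Finset U)
    (hCl : ∀ j, 2 ≤ (Cl j).card) :
    (∃ b : U → Bool, ∀ j, (∃ x ∈ Cl j, b x = true) ∧ (∃ y ∈ Cl j, b y = false)) ↔
    (∃ f : GV' U m → Fin 3, IsStrongCfvc (gadgetGraph' Cl) f) := by
  constructor
  · rintro ⟨b, hb⟩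
    exact ⟨assignmentColoring b, assignmentColoring_isStrongCfvc b hb⟩
  · rintro ⟨f, hf⟩
    have hne : ∀ j, (Cl j).Nonempty := fun j => Finset.card_pos.1 (two_pos.trans_le (hCl j))
    refine ⟨fun v => decide (f (.var v) = f (.H 0) + 1), fun j => ?_⟩
    obtain ⟨x, hx, hxc⟩ := exists_color_var_ne hf hne j (f (.H 0) + 2)
    obtain ⟨y, hy, hyc⟩ := exists_color_var_ne hf hne j (f (.H 0) + 1)
    have key : ∀ a b : Fin 3, a ≠ b → a ≠ b + 2 → a = b + 1 := by decide
    exact ⟨⟨x, hx, by simpa using key _ _ (hf.color_ne (adj_var_H x)) hxc⟩, y, hy,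
      by simpa using hyc⟩
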